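/- arXiv:2501.17769 — 2 statements merged into one kernel-verified Lean document; each statement's English description precedes it below -/
import Mathlib

section
/- Coequalizers via discrete objects: let C and D be categories and disc : D ⥤ C a functor with a right adjoint ob : C ⥤ D, via an adjunction disc ⊣ ob whose unit 𝟭 D ⟶ disc ⋙ ob is a natural isomorphism. Suppose (1) every parallel pair f, g : A ⟶ B in C with ob.map f = ob.map g has a coequalizer, and (2) for every X : D, every parallel pair f, g : disc.obj X ⟶ B in C has a coequalizer. Then C has coequalizers of all parallel pairs. -/
open CategoryTheory Limits

universe v₁ v₂ u₁ u₂

/-- If `f ≫ q` and `g ≫ q` have a coequalizer, where `q` is the coequalizer of `e ≫ f` and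
`e ≫ g`, then `f` and `g` have a coequalizer. -/
lemma hasCoequalizer_of_hasCoequalizer_precomp {C : Type u₁} [Category.{v₁} C] {E A B : C}
    (e : E ⟶ A) (f g : A ⟶ B) [HasCoequalizer (e ≫ f) (e ≫ g)]
    [HasCoequalizer (f ≫ coequalizer.π (e ≫ f) (e ≫ g))
      (g ≫ coequalizer.π (e ≫ f) (e ≫ g))] : HasCoequalizer f g := by
  let q := coequalizer.π (e ≫ f) (e ≫ g)
  let r := coequalizer.π (f ≫ q) (g ≫ q)
  have w : f ≫ q ≫ r = g ≫ q ≫ r := by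
    simpa only [Category.assoc] using coequalizer.condition (f ≫ q) (g ≫ q)
  have hq (s : Cofork f g) : (e ≫ f) ≫ s.π = (e ≫ g) ≫ s.π := by
    simp only [Category.assoc, s.condition]
  have hr (s : Cofork f g) : (f ≫ q) ≫ coequalizer.desc s.π (hq s) =
      (g ≫ q) ≫ coequalizer.desc s.π (hq s) := by
    simp only [q, Category.assoc, coequalizer.π_desc, s.condition]
  exact ⟨⟨Cofork.ofπ (q ≫ r) w, Cofork.IsColimit.mk _
    (fun s => coequalizer.desc (coequalizer.desc s.π (hq s)) (hr s))
    (fun s => by simp [q, r])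
    (fun s m hm => by
      refine coequalizer.hom_ext (f := f ≫ q) (g := g ≫ q) (coequalizer.hom_ext ?_)
      simpa [q, r] using hm)⟩⟩

/-- A right adjoint identifies two morphisms that agree after precomposition with the counit. -/
lemma map_eq_of_counit_comp_eq {C : Type u₁} [Category.{v₁} C] {D : Type u₂}
    [Category.{v₂} D] {F : D ⥤ C} {G : C ⥤ D} (adj : F ⊣ G) {A B : C} {f g : A ⟶ B}
    (h : adj.counit.app A ≫ f = adj.counit.app A ≫ g) : G.map f = G.map g := by
  simpa using congrArg (fun k => adj.unit.app (G.obj A) ≫ G.map k) h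

/-- Coequalisers via discrete objects: if `disc : D ⥤ C` has a right adjoint `ob` with
invertible unit, and `C` has coequalisers of pairs identified by `ob` as well as coequalisers
of pairs out of objects in the image of `disc`, then `C` has all coequalisers. -/
theorem hasCoequalizers_of_discrete {C : Type u₁} [Category.{v₁} C] {D : Type u₂}
    [Category.{v₂} D] (disc : D ⥤ C) (ob : C ⥤ D) (adj : disc ⊣ ob)
    (hunit : IsIso adj.unit)
    (h1 : ∀ {A B : C} (f g : A ⟶ B), ob.map f = ob.map g → HasCoequalizer f g)
    (h2 : ∀ (X : D) (B : C) (f g : disc.obj X ⟶ B), HasCoequalizer f g)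
    {A B : C} (f g : A ⟶ B) : HasCoequalizer f g := by
  have := h2 _ _ (adj.counit.app A ≫ f) (adj.counit.app A ≫ g)
  have := h1 (f ≫ coequalizer.π (adj.counit.app A ≫ f) (adj.counit.app A ≫ g))
    (g ≫ coequalizer.π (adj.counit.app A ≫ f) (adj.counit.app A ≫ g))
    (map_eq_of_counit_comp_eq adj
      (by simpa only [Category.assoc] using
        coequalizer.condition (adj.counit.app A ≫ f) (adj.counit.app A ≫ g)))
  exact hasCoequalizer_of_hasCoequalizer_precomp (adj.counit.app A) f g
end

section
/- The forgetful functor Quiv.forget : Cat ⥤ Quiv from small categories to quivers is monadic: it has a left adjoint (the free/path category functor) and the comparison functor to the Eilenberg–Moore category of the induced monad is an equivalence (MonadicRightAdjoint Quiv.forget). -/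
open CategoryTheory

universe u

/-- An operation composing every path of a quiver to a single arrow, compatible with the inclusion
of arrows as paths of length one and with the concatenation of paths. -/
structure PathEvaluation (V : Type*) [Quiver V] where
  /-- The arrow to which a path evaluates. -/
  eval {X Y : V} : Quiver.Path X Y → (X ⟶ Y)
  eval_toPath {X Y : V} (f : X ⟶ Y) : eval f.toPath = f
  eval_comp {X Y Z : V} (p : Quiver.Path X Y) (q : Quiver.Path Y Z) :
    eval (p.comp q) = eval ((eval p).toPath.comp (eval q).toPath)

namespace PathEvaluation

variable {V : Type*} [Quiver V] (E : PathEvaluation V)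

/-- The category structure on a quiver whose paths can be evaluated: identities evaluate empty
paths and composites evaluate paths of length two. -/
abbrev category : Category V where
  id _ := E.eval .nil
  comp f g := E.eval (f.toPath.comp g.toPath)
  id_comp f := by
    conv_lhs => rw [← E.eval_toPath f]
    rw [← E.eval_comp, Quiver.Path.nil_comp, E.eval_toPath]
  comp_id f := by
    conv_lhs => rw [← E.eval_toPath f]
    rw [← E.eval_comp, Quiver.Path.comp_nil, E.eval_toPath]
  assoc f g h := by
    conv_lhs => rw [← E.eval_toPath h]
    conv_rhs => rw [← E.eval_toPath f]
    rw [← E.eval_comp, ← E.eval_comp, Quiver.Path.comp_assoc]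

theorem composePath_eq_eval {X Y : V} (p : Quiver.Path X Y) :
    @composePath V E.category X Y p = E.eval p := by
  induction p with
  | nil => rfl
  | cons p f ih =>
    change E.eval ((@composePath V E.category _ _ p).toPath.comp f.toPath) = _
    rw [ih]
    conv_lhs => rw [← E.eval_toPath f]
    rw [← E.eval_comp]
    rfl

end PathEvaluation

/-- Every algebra for the path category monad comes from a category: its structure map evaluates
paths. -/
theorem quivForget_comparison_essSurj :
    (Monad.comparison Quiv.adj.{u, u}).EssSurj := by
  refine ⟨fun A => ?_⟩
  obtain ⟨V, a, hunit, hassoc⟩ := A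
  change Prefunctor (Paths V) V at a
  obtain ⟨o, m⟩ := a
  change Paths.of V ⋙q _ = 𝟭q V at hunit
  obtain rfl : o = fun X => X := funext fun X => Prefunctor.congr_obj hunit X
  let E : PathEvaluation V :=
    { eval := fun {X Y} p => m (X := X) (Y := Y) p
      eval_toPath := fun f => Prefunctor.congr_hom hunit f
      eval_comp := fun {X Y Z} p q => by
        have h := Prefunctor.congr_hom hassoc (X := X) (Y := Z)
          (Quiver.Path.cons (Quiver.Path.cons Quiver.Path.nil p) q)
        change m (composePath (C := Paths V) (.cons (.cons .nil p) q)) = _ at h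
        have hpq : composePath (C := Paths V) (.cons (.cons .nil p) q) =
            Quiver.Path.comp p q := congrArg (Quiver.Path.comp · q) (Quiver.Path.nil_comp p)
        rw [hpq] at h
        exact h }
  refine ⟨@Cat.of V E.category, ⟨Monad.Algebra.isoMk (Iso.refl _) ?_⟩⟩
  refine (congrArg (· ≫ _) (CategoryTheory.Functor.map_id _ _)).trans ?_
  refine (Category.id_comp _).trans (Eq.trans ?_ (Category.comp_id _).symm)
  refine congrArg (@Prefunctor.mk (Paths V) _ V _ fun X => X) ?_
  funext X Y p
  exact (E.composePath_eq_eval p).symm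

theorem quivForget_comparison_full :
    (Monad.comparison Quiv.adj.{u, u}).Full where
  map_surjective {C D} f := by
    obtain ⟨f, hf⟩ := f
    let F : Prefunctor C D := f
    have hcomp {X Y : C} (p : Quiver.Path X Y) :
        composePath (F.mapPath p) = F.map (composePath p) :=
      Prefunctor.congr_hom hf (X := X) (Y := Y) p
    refine ⟨Functor.toCatHom
      { obj := F.obj
        map := F.map
        map_id := fun X => (hcomp (.nil : Quiver.Path X X)).symm
        map_comp := fun g h => ?_ }, rfl⟩
    simpa using (hcomp (g.toPath.comp h.toPath)).symm

instance quivForget_faithful : Quiv.forget.{u, u}.Faithful where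
  map_injective {C D F G} h := by
    have h' : F.toFunctor.toPrefunctor = G.toFunctor.toPrefunctor := h
    ext1
    obtain ⟨F⟩ := F
    obtain ⟨G⟩ := G
    cases F
    cases G
    cases h'
    rfl

/-- The forgetful functor `Quiv.forget : Cat ⥤ Quiv` from small categories to quivers is
monadic. -/
theorem quivForget_monadic : Nonempty (MonadicRightAdjoint Quiv.forget.{u, u}) :=
  ⟨{ L := Cat.free
     adj := Quiv.adj
     eqv :=
      { full := quivForget_comparison_full
        essSurj := quivForget_comparison_essSurj } }⟩
end
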